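/- arXiv:2309.15479 — 2 statements merged into one kernel-verified Lean document; each statement's English description precedes it below -/
import Mathlib

section
/- Let μ̃ > 0 and σ̃ > 0. Let T be a real random variable with the truncated normal density ψ(x; μ̃, σ̃², 0, ∞), i.e., with density x ↦ φ((x−μ̃)/σ̃) / (σ̃ (1 − Φ(−μ̃/σ̃))) for x > 0 and 0 for x ≤ 0, let S = √T, and let X be a standard normal random variable independent of S. Define ε = σ̃ exp(−μ̃²/(2σ̃²)) / (√(2π) μ̃ (1 − Φ(−μ̃/σ̃))) and λ = σ̃²/μ̃² + ε. Then the first four moments of SX are: E[SX] = 0, E[(SX)²] = μ̃ (1 + ε), E[(SX)³] = 0, and E[(SX)⁴] = 3 μ̃² (1 + λ). -/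
open MeasureTheory ProbabilityTheory
open scoped ENNReal

/-- The standard normal probability density function `φ`. -/
noncomputable def stdGaussPDF (x : ℝ) : ℝ :=
  (Real.sqrt (2 * Real.pi))⁻¹ * Real.exp (-x ^ 2 / 2)

/-- The standard normal cumulative distribution function `Φ`. -/
noncomputable def stdGaussCDF (x : ℝ) : ℝ :=
  ∫ t in Set.Iic x, stdGaussPDF t

/-- The density of the normal distribution `N(μ̃, σ̃²)` truncated to `(0, ∞)`. -/
noncomputable def truncNormalPDF (μt σt : ℝ) (x : ℝ) : ℝ :=
  if 0 < x then stdGaussPDF ((x - μt) / σt) / (σt * (1 - stdGaussCDF (-μt / σt))) else 0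

lemma integrable_gaussianPDFReal_mul_pow (μ : ℝ) {v : NNReal} (hv : v ≠ 0) (n : ℕ) :
    Integrable (fun x => gaussianPDFReal μ v x * x ^ n) := by
  have h : Integrable (fun x : ℝ => x ^ n) (gaussianReal μ v) := by
    have h1 := (memLp_id_gaussianReal (μ := μ) (v := v) n).integrable_norm_pow'
    refine h1.mono' (by fun_prop) (Filter.Eventually.of_forall fun x => ?_)
    simp
  rw [gaussianReal_of_var_ne_zero μ hv, integrable_withDensity_iff_integrable_smul'
    (measurable_gaussianPDF μ v) (ae_of_all _ fun _ => gaussianPDF_lt_top)] at h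
  simpa [toReal_gaussianPDF] using h

lemma hasDerivAt_gaussianPDFReal (μ : ℝ) {v : NNReal} (hv : v ≠ 0) (x : ℝ) :
    HasDerivAt (gaussianPDFReal μ v) (-(x - μ) / v * gaussianPDFReal μ v x) x := by
  have hv' : (v : ℝ) ≠ 0 := by exact_mod_cast hv
  have h1 : HasDerivAt (fun x : ℝ => -(x - μ) ^ 2 / (2 * v)) (-(x - μ) / v) x := by
    have := ((((hasDerivAt_id x).sub_const μ).pow 2).neg).div_const (2 * (v : ℝ))
    refine this.congr_deriv ?_
    simp only [id]
    field_simp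
    norm_num [mul_comm]
  rw [gaussianPDFReal_def]
  refine (h1.exp.const_mul _).congr_deriv ?_
  ring

lemma hasDerivAt_gaussianPDFReal_mul_pow (μ : ℝ) {v : NNReal} (hv : v ≠ 0) (n : ℕ) (x : ℝ) :
    HasDerivAt (fun x => gaussianPDFReal μ v x * x ^ n)
      (n * (gaussianPDFReal μ v x * x ^ (n - 1)) +
        (μ / v * (gaussianPDFReal μ v x * x ^ n) -
          (v : ℝ)⁻¹ * (gaussianPDFReal μ v x * x ^ (n + 1)))) x := by
  refine ((hasDerivAt_gaussianPDFReal μ hv x).mul (hasDerivAt_pow n x)).congr_deriv ?_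
  ring

lemma integrable_deriv_gaussianPDFReal_mul_pow (μ : ℝ) {v : NNReal} (hv : v ≠ 0) (n : ℕ) :
    Integrable (fun x => n * (gaussianPDFReal μ v x * x ^ (n - 1)) +
        (μ / v * (gaussianPDFReal μ v x * x ^ n) -
          (v : ℝ)⁻¹ * (gaussianPDFReal μ v x * x ^ (n + 1)))) :=
  ((integrable_gaussianPDFReal_mul_pow μ hv _).const_mul _).add
    (((integrable_gaussianPDFReal_mul_pow μ hv _).const_mul _).sub
      ((integrable_gaussianPDFReal_mul_pow μ hv _).const_mul _))

/-- Recurrence for the moments of a Gaussian density on `(0, ∞)`. -/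
lemma setIntegral_Ioi_gaussianPDFReal_mul_pow_succ (μ : ℝ) {v : NNReal} (hv : v ≠ 0) (n : ℕ) :
    ∫ x in Set.Ioi 0, gaussianPDFReal μ v x * x ^ (n + 1) =
      μ * (∫ x in Set.Ioi 0, gaussianPDFReal μ v x * x ^ n) +
      v * (n * (∫ x in Set.Ioi 0, gaussianPDFReal μ v x * x ^ (n - 1)) +
        gaussianPDFReal μ v 0 * 0 ^ n) := by
  have hv' : (v : ℝ) ≠ 0 := by exact_mod_cast hv
  have hi := fun k => (integrable_gaussianPDFReal_mul_pow μ hv k).integrableOn (s := Set.Ioi 0)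
  have hd := (integrable_deriv_gaussianPDFReal_mul_pow μ hv n).integrableOn (s := Set.Ioi 0)
  have h := integral_Ioi_of_hasDerivAt_of_tendsto'
    (fun x _ => hasDerivAt_gaussianPDFReal_mul_pow μ hv n x) hd
    (tendsto_zero_of_hasDerivAt_of_integrableOn_Ioi
      (fun x _ => hasDerivAt_gaussianPDFReal_mul_pow μ hv n x) hd (hi n))
  have hsub : IntegrableOn (fun x => μ / v * (gaussianPDFReal μ v x * x ^ n) -
      (v : ℝ)⁻¹ * (gaussianPDFReal μ v x * x ^ (n + 1))) (Set.Ioi 0) :=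
    ((hi n).const_mul _).sub ((hi (n + 1)).const_mul _)
  rw [integral_add ((hi _).const_mul _) hsub,
    integral_sub ((hi _).const_mul _) ((hi _).const_mul _), integral_const_mul,
    integral_const_mul, integral_const_mul] at h
  field_simp at h
  linarith

/-- Recurrence for the moments of a Gaussian distribution. -/
lemma integral_pow_succ_gaussianReal (μ : ℝ) {v : NNReal} (hv : v ≠ 0) (n : ℕ) :
    ∫ x, x ^ (n + 1) ∂gaussianReal μ v =
      μ * (∫ x, x ^ n ∂gaussianReal μ v) + v * (n * ∫ x, x ^ (n - 1) ∂gaussianReal μ v) := by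
  have hv' : (v : ℝ) ≠ 0 := by exact_mod_cast hv
  have hi := fun k => integrable_gaussianPDFReal_mul_pow μ hv k
  have h := integral_eq_zero_of_hasDerivAt_of_integrable
    (fun x => hasDerivAt_gaussianPDFReal_mul_pow μ hv n x)
    (integrable_deriv_gaussianPDFReal_mul_pow μ hv n) (hi n)
  have hsub : Integrable (fun x => μ / v * (gaussianPDFReal μ v x * x ^ n) -
      (v : ℝ)⁻¹ * (gaussianPDFReal μ v x * x ^ (n + 1))) :=
    ((hi n).const_mul _).sub ((hi (n + 1)).const_mul _)
  rw [integral_add ((hi _).const_mul _) hsub,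
    integral_sub ((hi _).const_mul _) ((hi _).const_mul _), integral_const_mul,
    integral_const_mul, integral_const_mul] at h
  simp only [integral_gaussianReal_eq_integral_smul hv, smul_eq_mul]
  field_simp at h
  linarith

lemma truncNormalPDF_eq_indicator (μt : ℝ) {σt : ℝ} (hσt : 0 < σt) :
    truncNormalPDF μt σt = (Set.Ioi 0).indicator (fun x =>
      (1 - stdGaussCDF (-μt / σt))⁻¹ * gaussianPDFReal μt (σt ^ 2).toNNReal x) := by
  funext x
  have hs : Real.sqrt (2 * Real.pi * σt ^ 2) = Real.sqrt (2 * Real.pi) * σt := by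
    rw [Real.sqrt_mul (by positivity), Real.sqrt_sq hσt.le]
  simp only [truncNormalPDF, Set.indicator_apply, Set.mem_Ioi, stdGaussPDF, gaussianPDFReal,
    Real.coe_toNNReal _ (sq_nonneg σt), hs, div_eq_mul_inv, mul_inv]
  split_ifs
  · ring_nf
  · rfl

lemma measurable_truncNormalPDF (μt : ℝ) {σt : ℝ} (hσt : 0 < σt) :
    Measurable (truncNormalPDF μt σt) := by
  rw [truncNormalPDF_eq_indicator μt hσt]
  exact ((measurable_gaussianPDFReal _ _).const_mul _).indicator measurableSet_Ioi

/-- If the truncated normal density is that of a probability measure, its normalizing constant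
is positive. -/
lemma one_sub_stdGaussCDF_pos {μt σt : ℝ} (hσt : 0 < σt)
    (h : IsProbabilityMeasure
      (volume.withDensity (fun x => ENNReal.ofReal (truncNormalPDF μt σt x)))) :
    0 < 1 - stdGaussCDF (-μt / σt) := by
  by_contra! hZ
  have h0 : (fun x => ENNReal.ofReal (truncNormalPDF μt σt x)) = 0 := by
    funext x
    refine ENNReal.ofReal_of_nonpos ?_
    rw [truncNormalPDF_eq_indicator μt hσt]
    exact Set.indicator_nonpos (fun y _ => mul_nonpos_of_nonpos_of_nonneg
      (inv_nonpos.2 hZ) (gaussianPDFReal_nonneg _ _ _)) x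
  have := h.measure_univ
  simp [h0] at this

lemma integral_withDensity_truncNormalPDF {μt σt : ℝ} (hσt : 0 < σt)
    (hZ : 0 < 1 - stdGaussCDF (-μt / σt)) (f : ℝ → ℝ) :
    ∫ x, f x ∂(volume.withDensity (fun x => ENNReal.ofReal (truncNormalPDF μt σt x))) =
      (1 - stdGaussCDF (-μt / σt))⁻¹ *
        ∫ x in Set.Ioi 0, gaussianPDFReal μt (σt ^ 2).toNNReal x * f x := by
  rw [integral_withDensity_eq_integral_toReal_smul
    (measurable_truncNormalPDF μt hσt).ennreal_ofReal (ae_of_all _ fun _ => ENNReal.ofReal_lt_top),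
    ← integral_const_mul, ← integral_indicator measurableSet_Ioi]
  congr 1
  funext x
  rw [truncNormalPDF_eq_indicator μt hσt]
  by_cases hx : x ∈ Set.Ioi (0 : ℝ)
  · simp only [Set.indicator_of_mem hx, smul_eq_mul]
    rw [ENNReal.toReal_ofReal (mul_nonneg (inv_nonneg.2 hZ.le) (gaussianPDFReal_nonneg _ _ _)),
      mul_assoc]
  · simp [Set.indicator_of_notMem hx]

/-- First four moments of `S X`, where `S = √T`, `T` follows the normal distribution
`N(μ̃, σ̃²)` truncated to `(0, ∞)`, and `X` is standard normal independent of `S`: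
`E[SX] = 0`, `E[(SX)²] = μ̃(1+ε)`, `E[(SX)³] = 0`, `E[(SX)⁴] = 3μ̃²(1+λ)`. -/
theorem four_moments_sqrtTruncNormal_mul_gaussian
    {Ω : Type*} [MeasurableSpace Ω] (P : Measure Ω) [IsProbabilityMeasure P]
    (μt σt : ℝ) (hμt : 0 < μt) (hσt : 0 < σt)
    (T S X : Ω → ℝ) (hT : Measurable T) (hX : Measurable X)
    (hTlaw : Measure.map T P =
      volume.withDensity (fun x => ENNReal.ofReal (truncNormalPDF μt σt x)))
    (hS : S = fun ω => Real.sqrt (T ω))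
    (hXlaw : Measure.map X P = gaussianReal 0 1)
    (hindep : IndepFun S X P)
    (ε lam : ℝ)
    (hε : ε = σt * Real.exp (-μt ^ 2 / (2 * σt ^ 2)) /
      (Real.sqrt (2 * Real.pi) * μt * (1 - stdGaussCDF (-μt / σt))))
    (hlam : lam = σt ^ 2 / μt ^ 2 + ε) :
    (∫ ω, S ω * X ω ∂P = 0) ∧
    (∫ ω, (S ω * X ω) ^ 2 ∂P = μt * (1 + ε)) ∧
    (∫ ω, (S ω * X ω) ^ 3 ∂P = 0) ∧
    (∫ ω, (S ω * X ω) ^ 4 ∂P = 3 * μt ^ 2 * (1 + lam)) := by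
  have hprob : IsProbabilityMeasure
      (volume.withDensity (fun x => ENNReal.ofReal (truncNormalPDF μt σt x))) :=
    hTlaw ▸ Measure.isProbabilityMeasure_map hT.aemeasurable
  have hZ := one_sub_stdGaussCDF_pos hσt hprob
  have hint := integral_withDensity_truncNormalPDF hσt hZ
  have hmass := hint 1
  have hv : (σt ^ 2).toNNReal ≠ 0 := by simpa using hσt.ne'
  have hM1 := setIntegral_Ioi_gaussianPDFReal_mul_pow_succ μt hv 0
  have hM2 := setIntegral_Ioi_gaussianPDFReal_mul_pow_succ μt hv 1
  have hS_meas : Measurable S := hS ▸ hT.sqrt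
  have hSmom (k : ℕ) : ∫ ω, S ω ^ (2 * k) ∂P = (1 - stdGaussCDF (-μt / σt))⁻¹ *
      ∫ x in Set.Ioi 0, gaussianPDFReal μt (σt ^ 2).toNNReal x * x ^ k := by
    have h1 : ∫ ω, S ω ^ (2 * k) ∂P = ∫ x, Real.sqrt x ^ (2 * k) ∂(Measure.map T P) := by
      rw [integral_map hT.aemeasurable (by fun_prop), hS]
    rw [h1, hTlaw, hint]
    congr 1
    refine setIntegral_congr_fun measurableSet_Ioi fun x hx => ?_
    simp only [pow_mul, Real.sq_sqrt (le_of_lt (Set.mem_Ioi.1 hx))]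
  have hXmom (k : ℕ) : ∫ ω, X ω ^ k ∂P = ∫ x, x ^ k ∂gaussianReal 0 1 := by
    rw [← hXlaw, integral_map hX.aemeasurable (by fun_prop)]
  have hprod (k : ℕ) : ∫ ω, (S ω * X ω) ^ k ∂P =
      (∫ ω, S ω ^ k ∂P) * ∫ x, x ^ k ∂gaussianReal 0 1 := by
    simp only [mul_pow]
    rw [← hXmom]
    exact (hindep.comp (measurable_id.pow_const k)
      (measurable_id.pow_const k)).integral_fun_mul_eq_mul_integral
      (hS_meas.pow_const k).aestronglyMeasurable (hX.pow_const k).aestronglyMeasurable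
  have hrec := integral_pow_succ_gaussianReal 0 (one_ne_zero : (1 : NNReal) ≠ 0)
  have g1 : ∫ x : ℝ, x ^ 1 ∂gaussianReal 0 1 = 0 := by simp
  have g2 : ∫ x : ℝ, x ^ 2 ∂gaussianReal 0 1 = 1 := by simpa using hrec 1
  have g3 : ∫ x : ℝ, x ^ 3 ∂gaussianReal 0 1 = 0 := by
    have := hrec 2
    norm_num at this g1
    simp [this]
  have g4 : ∫ x : ℝ, x ^ 4 ∂gaussianReal 0 1 = 3 := by
    have := hrec 3
    norm_num at this g2
    simp [this, g2]
  have hs : Real.sqrt (2 * Real.pi * σt ^ 2) = Real.sqrt (2 * Real.pi) * σt := by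
    rw [Real.sqrt_mul (by positivity), Real.sqrt_sq hσt.le]
  have hg0 : σt ^ 2 * gaussianPDFReal μt (σt ^ 2).toNNReal 0 =
      μt * ε * (1 - stdGaussCDF (-μt / σt)) := by
    rw [hε, gaussianPDFReal, Real.coe_toNNReal _ (sq_nonneg σt), hs, zero_sub, neg_sq]
    have hpi : Real.sqrt (2 * Real.pi) ≠ 0 := by positivity
    have hZ' := hZ.ne'
    generalize 1 - stdGaussCDF (-μt / σt) = Z at hZ' ⊢
    field_simp
  simp only [Pi.one_apply, integral_const, probReal_univ, smul_eq_mul, mul_one] at hmass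
  rw [eq_comm, inv_mul_eq_one₀ hZ.ne'] at hmass
  simp only [zero_add, Nat.cast_zero, zero_mul, pow_zero, mul_one, ← hmass,
    Real.coe_toNNReal _ (sq_nonneg σt), hg0] at hM1
  simp only [Nat.cast_one, one_mul, Nat.sub_self, pow_zero, pow_one, mul_one, mul_zero, add_zero,
    ← hmass, Real.coe_toNNReal _ (sq_nonneg σt)] at hM1 hM2
  have hZ' := hZ.ne'
  refine ⟨?_, ?_, ?_, ?_⟩
  · have h1 := hprod 1
    rw [g1, mul_zero] at h1
    simpa only [pow_one] using h1
  · rw [hprod, g2, hSmom 1]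
    simp only [pow_one, hM1]
    generalize 1 - stdGaussCDF (-μt / σt) = Z at hZ' ⊢
    field_simp
  · rw [hprod, g3, mul_zero]
  · rw [hprod, g4, hSmom 2, hM2, hM1, hlam]
    generalize 1 - stdGaussCDF (-μt / σt) = Z at hZ' ⊢
    field_simp
    ring
end

section
/- The function h : (0, ∞) → ℝ defined by h(r) = r φ(1/r) / (1 − Φ(−1/r)) is strictly monotonically increasing, where φ(x) = (1/√(2π)) exp(−x²/2) and Φ(x) = ∫_{−∞}^x φ(t) dt are the standard normal probability density function and cumulative distribution function. -/
open MeasureTheory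

theorem stdGaussPDF_eq_gaussianPDFReal :
    stdGaussPDF = ProbabilityTheory.gaussianPDFReal 0 1 := by
  ext x
  simp [stdGaussPDF, ProbabilityTheory.gaussianPDFReal]

theorem stdGaussPDF_pos (x : ℝ) : 0 < stdGaussPDF x := by
  unfold stdGaussPDF
  positivity

theorem integrable_stdGaussPDF : Integrable stdGaussPDF := by
  rw [stdGaussPDF_eq_gaussianPDFReal]
  exact ProbabilityTheory.integrable_gaussianPDFReal 0 1

theorem stdGaussPDF_antitoneOn : AntitoneOn stdGaussPDF (Set.Ici 0) := by
  intro x hx y _ hxy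
  have hx : 0 ≤ x := hx
  unfold stdGaussPDF
  gcongr

theorem stdGaussCDF_mono : Monotone stdGaussCDF := fun _ _ hxy =>
  setIntegral_mono_set integrable_stdGaussPDF.integrableOn
    (ae_of_all _ fun t => (stdGaussPDF_pos t).le) (Set.Iic_subset_Iic.2 hxy).eventuallyLE

theorem stdGaussCDF_lt_one (x : ℝ) : stdGaussCDF x < 1 := by
  have htotal : stdGaussCDF x + ∫ t in Set.Ioi x, stdGaussPDF t = 1 := by
    rw [stdGaussCDF, intervalIntegral.integral_Iic_add_Ioi integrable_stdGaussPDF.integrableOn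
      integrable_stdGaussPDF.integrableOn, stdGaussPDF_eq_gaussianPDFReal]
    exact ProbabilityTheory.integral_gaussianPDFReal_eq_one 0 one_ne_zero
  have htail : 0 < ∫ t in Set.Ioi x, stdGaussPDF t := by
    rw [setIntegral_pos_iff_support_of_nonneg_ae (ae_of_all _ fun t => (stdGaussPDF_pos t).le)
      integrable_stdGaussPDF.integrableOn,
      Function.support_eq_univ fun t => (stdGaussPDF_pos t).ne']
    simp
  linarith

/-- The function `h(r) = r φ(1/r) / (1 - Φ(-1/r))` is strictly monotonically increasing
on `(0, ∞)`. -/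
theorem moment_deviation_strictMono :
    StrictMonoOn (fun r : ℝ => r * stdGaussPDF (1 / r) / (1 - stdGaussCDF (-(1 / r))))
      (Set.Ioi 0) := by
  intro r hr s hs hrs
  have hr : 0 < r := hr
  have hs : 0 < s := hs
  have hinv : 1 / s ≤ 1 / r := one_div_le_one_div_of_le hr hrs.le
  have hpdf : stdGaussPDF (1 / r) ≤ stdGaussPDF (1 / s) :=
    stdGaussPDF_antitoneOn (one_div_pos.2 hs).le (one_div_pos.2 hr).le hinv
  have hcdf : stdGaussCDF (-(1 / r)) ≤ stdGaussCDF (-(1 / s)) :=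
    stdGaussCDF_mono (neg_le_neg hinv)
  exact div_lt_div₀ (mul_lt_mul hrs hpdf (stdGaussPDF_pos _) hs.le)
    (sub_le_sub_left hcdf 1) (mul_pos hs (stdGaussPDF_pos _)).le
    (sub_pos.2 (stdGaussCDF_lt_one _))
end
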